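/- Let the system (2.25) be Jacobian and fix ζ ∈ {1,…,m}. For l = 1,…,r let ν^{0l} ∈ ℂ^{2n} be nonzero common eigenvectors of A₁,…,A_m, with A_j ν^{0l} = λ_l^j ν^{0l} (j = 1,…,m), and let ν^{ηl} (η = 1,…,s_l−1, s_l ≥ 2) satisfy (A_ζ − λ_l^ζ I) ν^{ηl} = η ν^{η−1,l}, where Σ_{l=1}^r s_l ≥ m+1. Let Ω ⊆ ℂ^n be a domain on which each ν^{0l}·γ is nonzero and admits an ℝ-differentiable branch L_l of its logarithm (exp∘L_l = ν^{0l}·γ), and let Ψ_{ηl} : Ω → ℂ be the unique solutions of the triangular systems ν^{ηl}·γ = Σ_{δ=1}^{η} C(η−1, δ−1) · Ψ_{δl} · (ν^{η−δ,l}·γ), η = 1,…,s_l−1. Assume that 𝔏_ζ Ψ_{1l} = 1 on Ω, 𝔏_ζ Ψ_{ηl} = 0 on Ω for η = 2,…,s_l−1, and that for every j ≠ ζ each function 𝔏_j Ψ_{ηl} equals a constant μ_{ηl}^{jζ} on Ω; set μ_{1l}^{ζζ} = 1 and μ_{ηl}^{ζζ} = 0 for η ≥ 2. Choose α ≤ r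 and integers ε_ξ with 0 ≤ ε_ξ ≤ s_ξ−1 and Σ_{ξ=1}^α ε_ξ = m−α+1, and let (h_{0ξ}; h_{qξ}, q = 1,…,ε_ξ; ξ = 1,…,α) be a nontrivial solution of the linear system Σ_{ξ=1}^α ( λ_ξ^j h_{0ξ} + Σ_{q=1}^{ε_ξ} μ_{qξ}^{jζ} h_{qξ} ) = 0, j = 1,…,m. Then the function F = exp( Σ_{ξ=1}^α h_{0ξ} L_ξ + Σ_{ξ=1}^α Σ_{q=1}^{ε_ξ} h_{qξ} Ψ_{qξ} ), i.e., F = Π_{ξ=1}^α (ν^{0ξ}·γ)^{h_{0ξ}} · exp( Σ_{q=1}^{ε_ξ} h_{qξ} Ψ_{qξ} ), is an ℝ-differentiable first integral of (2.25) on Ω: 𝔏_j F = 0 on Ω for all j = 1,…,m. -/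

import Mathlib

open Complex

noncomputable section

/-- Directional Wirtinger-type derivative along a complex coordinate line whose
"real" direction is `v` and "imaginary" direction is `iv`:
`(D_v f − i · D_{iv} f)/2`.  Taking `iv` to be the negative of the imaginary
direction produces the conjugate Wirtinger derivative `∂̄`. -/
def wirtD {E : Type*} [NormedAddCommGroup E] [NormedSpace ℝ E]
    (v iv : E) (f : E → ℂ) : E → ℂ :=
  fun p => (fderiv ℝ f p v - Complex.I * fderiv ℝ f p iv) / 2

variable {n m : ℕ}

/-- Wirtinger derivative `∂_{z_ξ}` on `ℂ^n`. -/
def DzV (ξ : Fin n) : ((Fin n → ℂ) → ℂ) → (Fin n → ℂ) → ℂ :=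
  wirtD (Pi.single ξ 1) (Pi.single ξ Complex.I)

/-- Wirtinger derivative `∂_{z̄_ξ}` on `ℂ^n`. -/
def DzbarV (ξ : Fin n) : ((Fin n → ℂ) → ℂ) → (Fin n → ℂ) → ℂ :=
  wirtD (Pi.single ξ 1) (-Pi.single ξ Complex.I)

/-- `γ(z) = (z₁,…,z_n, z̄₁,…,z̄_n)`, indexed by `Fin n ⊕ Fin n`. -/
def gam (z : Fin n → ℂ) : Fin n ⊕ Fin n → ℂ :=
  Sum.elim z fun ξ => (starRingEnd ℂ) (z ξ)

/-- `b·γ(z) = ∑ l b_l γ(z)_l`. -/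
def dotg (b : Fin n ⊕ Fin n → ℂ) (z : Fin n → ℂ) : ℂ :=
  ∑ l, b l * gam z l

/-- The linear map `A_j : ℂ^{2n} → ℂ^{2n}`, `(A_j b)_l = ∑_k a_{jkl} b_k`. -/
def Amap (a : Fin m → (Fin n ⊕ Fin n) → (Fin n ⊕ Fin n) → ℂ) (j : Fin m)
    (b : Fin n ⊕ Fin n → ℂ) : Fin n ⊕ Fin n → ℂ :=
  fun l => ∑ k, a j k l * b k

/-- The operator `𝔏_j` of system (2.25), with ℝ-linear coefficients
`a_{jk}(z) = ∑_τ a_{jkτ} γ(z)_τ`. -/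
def Lop (a : Fin m → (Fin n ⊕ Fin n) → (Fin n ⊕ Fin n) → ℂ) (j : Fin m)
    (F : (Fin n → ℂ) → ℂ) : (Fin n → ℂ) → ℂ :=
  fun z => ∑ ξ : Fin n,
    ((∑ τ, a j (Sum.inl ξ) τ * gam z τ) * DzV ξ F z +
     (∑ τ, a j (Sum.inr ξ) τ * gam z τ) * DzbarV ξ F z)

/-- The system (2.25) is Jacobian: all Poisson brackets `[𝔏_j, 𝔏_ζ]`
vanish. -/
def Jacobian (a : Fin m → (Fin n ⊕ Fin n) → (Fin n ⊕ Fin n) → ℂ) : Prop :=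
  ∀ j ζ : Fin m, ∀ F : (Fin n → ℂ) → ℂ, ContDiff ℝ (⊤ : ℕ∞) F →
    ∀ z, Lop a j (Lop a ζ F) z = Lop a ζ (Lop a j F) z

/-- The value of `𝔏_j` at `z` as a `ℂ`-linear functional of the real derivative. -/
def lopForm (a : Fin m → (Fin n ⊕ Fin n) → (Fin n ⊕ Fin n) → ℂ) (j : Fin m) (z : Fin n → ℂ) :
    ((Fin n → ℂ) →L[ℝ] ℂ) →ₗ[ℂ] ℂ where
  toFun T := ∑ ξ : Fin n,
    ((∑ τ, a j (Sum.inl ξ) τ * gam z τ) *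
        ((T (Pi.single ξ 1) - Complex.I * T (Pi.single ξ Complex.I)) / 2) +
     (∑ τ, a j (Sum.inr ξ) τ * gam z τ) *
        ((T (Pi.single ξ 1) - Complex.I * T (-Pi.single ξ Complex.I)) / 2))
  map_add' S T := by
    rw [← Finset.sum_add_distrib]
    refine Finset.sum_congr rfl fun ξ _ => ?_
    simp only [add_apply]
    ring
  map_smul' c T := by
    simp only [RingHom.id_apply, smul_eq_mul, Finset.mul_sum (a := c)]
    refine Finset.sum_congr rfl fun ξ _ => ?_
    simp only [smul_apply, smul_eq_mul]
    ring

lemma Lop_eq_lopForm (a : Fin m → (Fin n ⊕ Fin n) → (Fin n ⊕ Fin n) → ℂ) (j : Fin m)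
    (F : (Fin n → ℂ) → ℂ) (z : Fin n → ℂ) :
    Lop a j F z = lopForm a j z (fderiv ℝ F z) := rfl

/-- `b·γ` as a continuous real-linear functional. -/
def dotgCLM (b : Fin n ⊕ Fin n → ℂ) : (Fin n → ℂ) →L[ℝ] ℂ :=
  LinearMap.toContinuousLinearMap
    { toFun := dotg b
      map_add' := fun x y => by
        simp only [dotg, gam, Fintype.sum_sum_type, Sum.elim_inl, Sum.elim_inr, Pi.add_apply,
          map_add, mul_add, Finset.sum_add_distrib]
        ring
      map_smul' := fun c x => by
        simp only [dotg, gam, Fintype.sum_sum_type, Sum.elim_inl, Sum.elim_inr, Pi.smul_apply,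
          Complex.real_smul, map_mul, Complex.conj_ofReal, RingHom.id_apply, mul_add,
          Finset.mul_sum, mul_left_comm] }

lemma hasFDerivAt_dotg (b : Fin n ⊕ Fin n → ℂ) (z : Fin n → ℂ) :
    HasFDerivAt (dotg b) (dotgCLM b) z :=
  (dotgCLM b).hasFDerivAt

lemma dotg_single (b : Fin n ⊕ Fin n → ℂ) (ξ : Fin n) (c : ℂ) :
    dotg b (Pi.single ξ c) = b (Sum.inl ξ) * c + b (Sum.inr ξ) * (starRingEnd ℂ) c := by
  simp [dotg, gam, Pi.single_apply, apply_ite (starRingEnd ℂ)]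

lemma dotg_smul (c : ℂ) (b : Fin n ⊕ Fin n → ℂ) (z : Fin n → ℂ) :
    dotg (c • b) z = c * dotg b z := by
  simp only [dotg, Finset.mul_sum, Pi.smul_apply, smul_eq_mul, mul_assoc]

lemma Lop_dotg (a : Fin m → (Fin n ⊕ Fin n) → (Fin n ⊕ Fin n) → ℂ) (j : Fin m)
    (b : Fin n ⊕ Fin n → ℂ) (z : Fin n → ℂ) :
    Lop a j (dotg b) z = dotg (Amap a j b) z := by
  have hz (ξ : Fin n) : DzV ξ (dotg b) z = b (Sum.inl ξ) := by
    simp only [DzV, wirtD, (hasFDerivAt_dotg b z).fderiv]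
    change (dotg b _ - I * dotg b _) / 2 = _
    rw [dotg_single, dotg_single, map_one, Complex.conj_I]
    linear_combination ((b (Sum.inr ξ) - b (Sum.inl ξ)) / 2) * Complex.I_mul_I
  have hzb (ξ : Fin n) : DzbarV ξ (dotg b) z = b (Sum.inr ξ) := by
    simp only [DzbarV, wirtD, (hasFDerivAt_dotg b z).fderiv, map_neg]
    change (dotg b _ - I * -dotg b _) / 2 = _
    rw [dotg_single, dotg_single, map_one, Complex.conj_I]
    linear_combination ((b (Sum.inl ξ) - b (Sum.inr ξ)) / 2) * Complex.I_mul_I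
  simp only [Lop, hz, hzb]
  rw [Finset.sum_add_distrib, ← Fintype.sum_sum_type (f := fun k =>
    (∑ τ, a j k τ * gam z τ) * b k)]
  simp only [dotg, Amap, Finset.sum_mul]
  rw [Finset.sum_comm]
  refine Finset.sum_congr rfl fun l _ => Finset.sum_congr rfl fun k _ => by ring

lemma Lop_cexp (a : Fin m → (Fin n ⊕ Fin n) → (Fin n ⊕ Fin n) → ℂ) (j : Fin m)
    {G : (Fin n → ℂ) → ℂ} {z : Fin n → ℂ} (hG : DifferentiableAt ℝ G z) :
    Lop a j (fun y => Complex.exp (G y)) z = Complex.exp (G z) * Lop a j G z := by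
  rw [Lop_eq_lopForm, hG.hasFDerivAt.cexp.fderiv, map_smul, smul_eq_mul, ← Lop_eq_lopForm]

/-- A logarithm of `b·γ`, with `b` an eigenvector of `A_j`, is mapped by `𝔏_j` to the
eigenvalue. -/
lemma Lop_log_dotg (a : Fin m → (Fin n ⊕ Fin n) → (Fin n ⊕ Fin n) → ℂ) (j : Fin m)
    {b : Fin n ⊕ Fin n → ℂ} {c : ℂ} (hb : Amap a j b = c • b)
    {Ω : Set (Fin n → ℂ)} (hΩ : IsOpen Ω) {L : (Fin n → ℂ) → ℂ}
    (hexp : ∀ z ∈ Ω, Complex.exp (L z) = dotg b z) {z : Fin n → ℂ} (hz : z ∈ Ω)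
    (hL : DifferentiableAt ℝ L z) : Lop a j L z = c := by
  have hev : (fun y => Complex.exp (L y)) =ᶠ[nhds z] dotg b :=
    Filter.eventually_of_mem (hΩ.mem_nhds hz) hexp
  have h := Lop_cexp a j hL
  rw [Lop_eq_lopForm, hev.fderiv_eq, ← Lop_eq_lopForm, Lop_dotg, hb, dotg_smul, ← hexp z hz,
    mul_comm c] at h
  exact (mul_left_cancel₀ (Complex.exp_ne_zero _) h).symm

/-- Solutions of the triangular system with nonvanishing leading coefficient are
differentiable. -/
lemma differentiableAt_of_triangular {ν : ℕ → Fin n ⊕ Fin n → ℂ} {Ψ : ℕ → (Fin n → ℂ) → ℂ}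
    {N : ℕ} {Ω : Set (Fin n → ℂ)} (hΩ : IsOpen Ω) (hnz : ∀ z ∈ Ω, dotg (ν 0) z ≠ 0)
    (hΨ : ∀ η, 1 ≤ η → η ≤ N → ∀ z ∈ Ω, dotg (ν η) z = ∑ δ ∈ Finset.Icc 1 η,
      (Nat.choose (η - 1) (δ - 1) : ℂ) * Ψ δ z * dotg (ν (η - δ)) z)
    {z : Fin n → ℂ} (hz : z ∈ Ω) (η : ℕ) (h1 : 1 ≤ η) (hN : η ≤ N) :
    DifferentiableAt ℝ (Ψ η) z := by
  have hd (b : Fin n ⊕ Fin n → ℂ) : DifferentiableAt ℝ (dotg b) z :=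
    (hasFDerivAt_dotg b z).differentiableAt
  induction η using Nat.strong_induction_on with
  | _ η ih =>
    have hev : Ψ η =ᶠ[nhds z] fun y => (dotg (ν η) y - ∑ δ ∈ Finset.Ico 1 η,
        (Nat.choose (η - 1) (δ - 1) : ℂ) * Ψ δ y * dotg (ν (η - δ)) y) * (dotg (ν 0) y)⁻¹ := by
      filter_upwards [hΩ.mem_nhds hz] with y hy
      rw [eq_mul_inv_iff_mul_eq₀ (hnz y hy), hΨ η h1 hN y hy,
        ← Finset.Ico_insert_right h1, Finset.sum_insert (by simp)]
      simp
    refine DifferentiableAt.congr_of_eventuallyEq ?_ hev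
    refine ((hd _).sub (DifferentiableAt.fun_sum fun δ hδ => ?_)).mul ((hd _).inv (hnz z hz))
    rw [Finset.mem_Ico] at hδ
    exact ((ih δ hδ.2 hδ.1 (hδ.2.le.trans hN)).const_mul _).mul (hd _)

/-- **Theorem 2.11.** Spectral construction of an ℝ-differentiable first
integral of the Jacobian system (2.25) from common eigenvectors `ν^{0l}` of
`A₁,…,A_m`, generalized eigenvectors `ν^{ηl}` of `A_ζ`, the associated
logarithms `L_l` of `ν^{0l}·γ` and the functions `Ψ_{ηl}`. -/
theorem statement_19 {n m : ℕ}
    (a : Fin m → (Fin n ⊕ Fin n) → (Fin n ⊕ Fin n) → ℂ)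
    (hJac : Jacobian a) (ζ : Fin m)
    (r : ℕ) (ν : ℕ → ℕ → Fin n ⊕ Fin n → ℂ)
    (lam : ℕ → Fin m → ℂ) (s : ℕ → ℕ)
    (hs2 : ∀ l < r, 2 ≤ s l)
    (hsum : m + 1 ≤ ∑ l ∈ Finset.range r, s l)
    (hν0 : ∀ l < r, ν l 0 ≠ 0)
    (heig : ∀ l < r, ∀ j, Amap a j (ν l 0) = lam l j • ν l 0)
    (hgen : ∀ l < r, ∀ η, 1 ≤ η → η ≤ s l - 1 →
      Amap a ζ (ν l η) = lam l ζ • ν l η + (η : ℂ) • ν l (η - 1))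
    (Ω : Set (Fin n → ℂ)) (hΩo : IsOpen Ω) (hΩc : IsConnected Ω)
    (hnz : ∀ l < r, ∀ z ∈ Ω, dotg (ν l 0) z ≠ 0)
    (L : ℕ → (Fin n → ℂ) → ℂ)
    (hL : ∀ l < r, ∀ z ∈ Ω, DifferentiableAt ℝ (L l) z)
    (hexp : ∀ l < r, ∀ z ∈ Ω, Complex.exp (L l z) = dotg (ν l 0) z)
    (Ψ : ℕ → ℕ → (Fin n → ℂ) → ℂ)
    (hΨ : ∀ l < r, ∀ η, 1 ≤ η → η ≤ s l - 1 → ∀ z ∈ Ω,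
      dotg (ν l η) z = ∑ δ ∈ Finset.Icc 1 η,
        (Nat.choose (η - 1) (δ - 1) : ℂ) * Ψ l δ z * dotg (ν l (η - δ)) z)
    (μc : ℕ → ℕ → Fin m → ℂ)
    (hμζ1 : ∀ l < r, μc l 1 ζ = 1)
    (hμζ : ∀ l < r, ∀ η, 2 ≤ η → μc l η ζ = 0)
    (hμ : ∀ l < r, ∀ η, 1 ≤ η → η ≤ s l - 1 → ∀ j, ∀ z ∈ Ω,
      Lop a j (Ψ l η) z = μc l η j)
    (α : ℕ) (hα : α ≤ r)
    (ε : ℕ → ℕ) (hε : ∀ ξ < α, ε ξ ≤ s ξ - 1)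
    (hεsum : ∑ ξ ∈ Finset.range α, ε ξ = m - α + 1)
    (h0 : ℕ → ℂ) (hq : ℕ → ℕ → ℂ)
    (hnontriv : ¬ (∀ ξ < α, h0 ξ = 0 ∧ ∀ q ∈ Finset.Icc 1 (ε ξ), hq ξ q = 0))
    (hsol : ∀ j, ∑ ξ ∈ Finset.range α,
      (lam ξ j * h0 ξ + ∑ q ∈ Finset.Icc 1 (ε ξ), μc ξ q j * hq ξ q) = 0) :
    ∀ j, ∀ z ∈ Ω,
      Lop a j (fun y => Complex.exp (∑ ξ ∈ Finset.range α,
        (h0 ξ * L ξ y + ∑ q ∈ Finset.Icc 1 (ε ξ), hq ξ q * Ψ ξ q y))) z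
        = 0 := by
  intro j z hz
  have hdL : ∀ ξ ∈ Finset.range α, DifferentiableAt ℝ (L ξ) z := fun ξ hξ =>
    hL ξ ((Finset.mem_range.1 hξ).trans_le hα) z hz
  have hdΨ : ∀ ξ ∈ Finset.range α, ∀ q ∈ Finset.Icc 1 (ε ξ), DifferentiableAt ℝ (Ψ ξ q) z := by
    intro ξ hξ q hq'
    have hξ' := Finset.mem_range.1 hξ
    rw [Finset.mem_Icc] at hq'
    exact differentiableAt_of_triangular hΩo (hnz ξ (hξ'.trans_le hα))
      (hΨ ξ (hξ'.trans_le hα)) hz q hq'.1 (hq'.2.trans (hε ξ hξ'))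
  have hG := HasFDerivAt.fun_sum fun ξ hξ =>
    ((hdL ξ hξ).hasFDerivAt.const_mul (h0 ξ)).fun_add
      (HasFDerivAt.fun_sum fun q hq' => (hdΨ ξ hξ q hq').hasFDerivAt.const_mul (hq ξ q))
  rw [Lop_cexp a j hG.differentiableAt, Lop_eq_lopForm, hG.fderiv]
  simp only [map_sum, map_add, map_smul, smul_eq_mul, ← Lop_eq_lopForm]
  rw [← mul_zero (Complex.exp _), ← hsol j]
  congr 1
  refine Finset.sum_congr rfl fun ξ hξ => ?_
  have hξ' := Finset.mem_range.1 hξ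
  have hξr := hξ'.trans_le hα
  rw [Lop_log_dotg a j (heig ξ hξr j) hΩo (hexp ξ hξr) hz (hdL ξ hξ), mul_comm (h0 ξ)]
  congr 1
  refine Finset.sum_congr rfl fun q hq' => ?_
  rw [Finset.mem_Icc] at hq'
  rw [hμ ξ hξr q hq'.1 (hq'.2.trans (hε ξ hξ')) j z hz, mul_comm]
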